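/- arXiv:1907.05324 — 3 statements merged into one kernel-verified Lean document; each statement's English description precedes it below -/
import Mathlib

section
/- Weak-duality lower bound on the maximin value: for every q ∈ 𝒫(𝒯^n) and every collection of real-valued functions γ^S on 𝒮^k, γ^C on 𝒴^n, λ^S on 𝒮^k×𝒮^k×𝒴^n, λ^C on 𝒳^n×𝒮^k×𝒴^n satisfying (I) γ^S(s) ≤ Σ_y λ^C(x,s,y) for all x ∈ 𝒳^n, s ∈ 𝒮^k; (II) γ^C(y) ≤ Σ_s λ^S(s,ŝ,y) for all ŝ ∈ 𝒮^k, y ∈ 𝒴^n; and (III) λ^S(s,ŝ,y) + λ^C(x,s,y) ≤ 𝟙{d(s,ŝ)>𝐝} P_S(s) P_{Y_q|X}(y|x) for all s,x,y,ŝ; the lower value satisfies ν̲(k,n) ≥ Σ_{s∈𝒮^k} γ^S(s) + Σ_{y∈𝒴^n} γ^C(y). -/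
open scoped BigOperators
open Classical MeasureTheory Filter

noncomputable section

namespace AVCGame

/-- A probability mass function on a finite type, as a real-valued function. -/
def IsDist {α : Type*} [Fintype α] (p : α → ℝ) : Prop :=
  (∀ a, 0 ≤ p a) ∧ ∑ a, p a = 1

/-- The set of probability distributions on a finite type. -/
abbrev ProbDist (α : Type*) [Fintype α] := {p : α → ℝ // IsDist p}

/-- Conditional probability distributions (channels/kernels). -/
abbrev Kernel (α β : Type*) [Fintype β] := {Q : α → β → ℝ // ∀ a, IsDist (Q a)}

/-- Real-valued indicator of a proposition. -/
def ind (P : Prop) : ℝ := if P then 1 else 0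

variable {𝒮 𝒳 𝒴 𝒯 α β : Type*}

/-- Memoryless `n`-letter extension of a state-dependent channel. -/
def nCh (W : 𝒯 → 𝒳 → 𝒴 → ℝ) (n : ℕ) (θ : Fin n → 𝒯) (x : Fin n → 𝒳) (y : Fin n → 𝒴) : ℝ :=
  ∏ i, W (θ i) (x i) (y i)

/-- i.i.d. product distribution on `k`-letter strings. -/
def prodF (p : α → ℝ) (k : ℕ) (s : Fin k → α) : ℝ := ∏ i, p (s i)

/-- Block (per-letter averaged) distortion. -/
def dBlock (dS : 𝒮 → 𝒮 → ℝ) (k : ℕ) (s s' : Fin k → 𝒮) : ℝ := (∑ i, dS (s i) (s' i)) / k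

section Values

variable [Fintype 𝒮] [Fintype 𝒳] [Fintype 𝒴] [Fintype 𝒯]

/-- Probability of exceeding distortion `D` under a stochastic code and jammer distribution. -/
def errP (W : 𝒯 → 𝒳 → 𝒴 → ℝ) (PS : 𝒮 → ℝ) (dS : 𝒮 → 𝒮 → ℝ) (D : ℝ) (k n : ℕ)
    (QXS : (Fin k → 𝒮) → (Fin n → 𝒳) → ℝ)
    (QSY : (Fin n → 𝒴) → (Fin k → 𝒮) → ℝ)
    (q : (Fin n → 𝒯) → ℝ) : ℝ :=
  ∑ θ : Fin n → 𝒯, ∑ s : Fin k → 𝒮, ∑ x : Fin n → 𝒳, ∑ y : Fin n → 𝒴, ∑ s' : Fin k → 𝒮,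
    ind (dBlock dS k s s' > D) * q θ * prodF PS k s * QXS s x * nCh W n θ x y * QSY y s'

/-- Upper (minimax) value of the zero-sum game. -/
def upperVal (W : 𝒯 → 𝒳 → 𝒴 → ℝ) (PS : 𝒮 → ℝ) (dS : 𝒮 → 𝒮 → ℝ) (D : ℝ) (k n : ℕ) : ℝ :=
  ⨅ QXS : Kernel (Fin k → 𝒮) (Fin n → 𝒳), ⨅ QSY : Kernel (Fin n → 𝒴) (Fin k → 𝒮),
    ⨆ q : ProbDist (Fin n → 𝒯), errP W PS dS D k n QXS.1 QSY.1 q.1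

/-- Lower (maximin) value of the zero-sum game. -/
def lowerVal (W : 𝒯 → 𝒳 → 𝒴 → ℝ) (PS : 𝒮 → ℝ) (dS : 𝒮 → 𝒮 → ℝ) (D : ℝ) (k n : ℕ) : ℝ :=
  ⨆ q : ProbDist (Fin n → 𝒯), ⨅ QXS : Kernel (Fin k → 𝒮) (Fin n → 𝒳),
    ⨅ QSY : Kernel (Fin n → 𝒴) (Fin k → 𝒮), errP W PS dS D k n QXS.1 QSY.1 q.1

end Values

/-- Mutual information (base 2) between the input of a channel `Wc` with input law `P`
and the corresponding output. -/
def mutInfo [Fintype α] [Fintype β] (P : α → ℝ) (Wc : α → β → ℝ) : ℝ :=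
  ∑ x, ∑ y, P x * Wc x y * Real.logb 2 (Wc x y / ∑ x', P x' * Wc x' y)

/-- The single-letter channel averaged over a state distribution. -/
def avgCh [Fintype 𝒯] (W : 𝒯 → 𝒳 → 𝒴 → ℝ) (qθ : 𝒯 → ℝ) (x : 𝒳) (y : 𝒴) : ℝ :=
  ∑ θ, qθ θ * W θ x y

/-- Randomized-code capacity of the AVC: `max_P min_q I(X;Y_q)`. -/
def capacity [Fintype 𝒳] [Fintype 𝒴] [Fintype 𝒯] (W : 𝒯 → 𝒳 → 𝒴 → ℝ) : ℝ :=
  ⨆ P : ProbDist 𝒳, ⨅ q : ProbDist 𝒯, mutInfo P.1 (avgCh W q.1)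

/-- Capacity-achieving state distributions. -/
def PiTheta [Fintype 𝒳] [Fintype 𝒴] [Fintype 𝒯] (W : 𝒯 → 𝒳 → 𝒴 → ℝ) : Set (ProbDist 𝒯) :=
  {q | (⨆ P : ProbDist 𝒳, mutInfo P.1 (avgCh W q.1)) = capacity W}

/-- Capacity-achieving input distributions. -/
def PiX [Fintype 𝒳] [Fintype 𝒴] [Fintype 𝒯] (W : 𝒯 → 𝒳 → 𝒴 → ℝ) : Set (ProbDist 𝒳) :=
  {P | (⨅ q : ProbDist 𝒯, mutInfo P.1 (avgCh W q.1)) = capacity W}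

/-- Information density (base 2) of a channel `Wc` with input law `P`. -/
def infoDens [Fintype α] (P : α → ℝ) (Wc : α → β → ℝ) (x : α) (y : β) : ℝ :=
  Real.logb 2 (Wc x y / ∑ x', P x' * Wc x' y)

/-- Variance of the information density under the joint law `P × Wc`. -/
def varInfoDens [Fintype α] [Fintype β] (P : α → ℝ) (Wc : α → β → ℝ) : ℝ :=
  ∑ x, ∑ y, P x * Wc x y * (infoDens P Wc x y - mutInfo P Wc) ^ 2

/-- Channel dispersion (for a given, typically unique, capacity achieving state
distribution `qθ`): the minimum over capacity achieving inputs of the variance of the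
information density. -/
def VC [Fintype 𝒳] [Fintype 𝒴] [Fintype 𝒯] (W : 𝒯 → 𝒳 → 𝒴 → ℝ) (qθ : 𝒯 → ℝ) : ℝ :=
  ⨅ P : PiX W, varInfoDens P.1.1 (avgCh W qθ)

/-- Rate-distortion function of a source `P` with distortion measure `dist` at level `D`. -/
def RD [Fintype α] (P : α → ℝ) (dist : α → α → ℝ) (D : ℝ) : ℝ :=
  ⨅ K : {K : Kernel α α // ∑ a, ∑ b, P a * K.1 a b * dist a b ≤ D}, mutInfo P K.1.1

/-- `λ* = -R'(D)`. -/
def lamStar [Fintype α] (P : α → ℝ) (dist : α → α → ℝ) (D : ℝ) : ℝ :=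
  -(deriv (RD P dist) D)

/-- `K` is a minimizer in the rate-distortion problem. -/
def IsRDMinimizer [Fintype α] (P : α → ℝ) (dist : α → α → ℝ) (D : ℝ) (K : α → α → ℝ) : Prop :=
  (∀ a, IsDist (K a)) ∧ (∑ a, ∑ b, P a * K a b * dist a b ≤ D) ∧ mutInfo P K = RD P dist D

/-- Output marginal of a source `P` through a kernel `K`. -/
def outMarg [Fintype α] (P : α → ℝ) (K : α → α → ℝ) (b : α) : ℝ := ∑ a, P a * K a b

/-- The `D`-tilted information, defined from a rate-distortion minimizer `K`. -/
def dtilted [Fintype α] (P : α → ℝ) (dist : α → α → ℝ) (D : ℝ) (K : α → α → ℝ) (a : α) : ℝ :=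
  - Real.logb 2 (∑ b, outMarg P K b *
      (2 : ℝ) ^ (lamStar P dist D * D - lamStar P dist D * dist a b))

/-- Variance of `f` under the distribution `P`. -/
def varOf [Fintype α] (P : α → ℝ) (f : α → ℝ) : ℝ :=
  ∑ a, P a * (f a - ∑ b, P b * f b) ^ 2

/-- Finiteness of the `D`-tilted information: the expectation inside the logarithm is
strictly positive. -/
def TiltFinite [Fintype α] (P : α → ℝ) (dist : α → α → ℝ) (D : ℝ) (K : α → α → ℝ) : Prop :=
  ∀ a, 0 < ∑ b, outMarg P K b *
      (2 : ℝ) ^ (lamStar P dist D * D - lamStar P dist D * dist a b)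

/-- Finiteness of the single-letter information density `i(x;Y)` for every input
distribution: whenever the channel output probability is positive, so is the output
marginal. -/
def InfoDensFinite [Fintype 𝒳] [Fintype 𝒴] [Fintype 𝒯] (W : 𝒯 → 𝒳 → 𝒴 → ℝ)
    (qθ : 𝒯 → ℝ) : Prop :=
  ∀ (P : ProbDist 𝒳) (x : 𝒳) (y : 𝒴), 0 < avgCh W qθ x y → 0 < ∑ x', P.1 x' * avgCh W qθ x' y

/-- Symmetrizability of the AVC. -/
def Symmetrizable [Fintype 𝒯] (W : 𝒯 → 𝒳 → 𝒴 → ℝ) : Prop :=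
  ∃ σ : 𝒳 → 𝒯 → ℝ, (∀ x, IsDist (σ x)) ∧
    ∀ x x' y, ∑ θ, σ x θ * W θ x' y = ∑ θ, σ x' θ * W θ x y

/-- Complementary standard Gaussian CDF. -/
def Qc (t : ℝ) : ℝ := ∫ u in Set.Ioi t, Real.exp (-(u ^ 2) / 2) / Real.sqrt (2 * Real.pi)

/-- Inverse of the complementary standard Gaussian CDF. -/
def Qcinv (ε : ℝ) : ℝ := Function.invFun Qc ε

/-- `n`-letter channel averaged over a jammer distribution on state sequences. -/
def avgChnQ [Fintype 𝒯] (W : 𝒯 → 𝒳 → 𝒴 → ℝ) (n : ℕ) (q : (Fin n → 𝒯) → ℝ)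
    (x : Fin n → 𝒳) (y : Fin n → 𝒴) : ℝ :=
  ∑ θ : Fin n → 𝒯, q θ * nCh W n θ x y

/-- `n`-letter channel averaged over the i.i.d. extension of a single-letter state law. -/
def avgChn [Fintype 𝒯] (W : 𝒯 → 𝒳 → 𝒴 → ℝ) (qθ : 𝒯 → ℝ) (n : ℕ)
    (x : Fin n → 𝒳) (y : Fin n → 𝒴) : ℝ :=
  ∑ θ : Fin n → 𝒯, prodF qθ n θ * nCh W n θ x y

/-- Probability of the distortion ball `B_D(s)` under a distribution on `𝒮^k`. -/
def ballProb [Fintype 𝒮] (dS : 𝒮 → 𝒮 → ℝ) (D : ℝ) (k : ℕ)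
    (PShat : (Fin k → 𝒮) → ℝ) (s : Fin k → 𝒮) : ℝ :=
  ∑ s', ind (dBlock dS k s s' ≤ D) * PShat s'

/-- Error of a deterministic joint source-channel code against state sequence `θ`. -/
def eCode [Fintype 𝒮] [Fintype 𝒴] (W : 𝒯 → 𝒳 → 𝒴 → ℝ) (PS : 𝒮 → ℝ) (dS : 𝒮 → 𝒮 → ℝ)
    (D : ℝ) (k n : ℕ) (f : (Fin k → 𝒮) → Fin n → 𝒳) (φ : (Fin n → 𝒴) → Fin k → 𝒮)
    (θ : Fin n → 𝒯) : ℝ :=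
  ∑ s : Fin k → 𝒮, ∑ y : Fin n → 𝒴,
    ind (dBlock dS k s (φ y) > D) * prodF PS k s * nCh W n θ (f s) y

/-- Deterministic joint source-channel code pairs. -/
abbrev CodePair (𝒮 𝒳 𝒴 : Type*) (k n : ℕ) :=
  ((Fin k → 𝒮) → Fin n → 𝒳) × ((Fin n → 𝒴) → Fin k → 𝒮)

/-- Worst-case (over states) error of a random joint source-channel code `ψ`. -/
def eRandMax [Fintype 𝒮] [Fintype 𝒳] [Fintype 𝒴] [Fintype 𝒯]
    [DecidableEq 𝒮] [DecidableEq 𝒴]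
    (W : 𝒯 → 𝒳 → 𝒴 → ℝ) (PS : 𝒮 → ℝ) (dS : 𝒮 → 𝒮 → ℝ) (D : ℝ) (k n : ℕ)
    (ψ : CodePair 𝒮 𝒳 𝒴 k n → ℝ) : ℝ :=
  ⨆ θ : Fin n → 𝒯, ∑ c : CodePair 𝒮 𝒳 𝒴 k n, ψ c * eCode W PS dS D k n c.1 c.2 θ

/-- Kullback-Leibler divergence (base 2) between pmfs on a finite type. -/
def klDiv [Fintype α] (P Q : α → ℝ) : ℝ := ∑ a, P a * Real.logb 2 (P a / Q a)

/-- The reference measure `P_X × Q_{X'Θ} × P_{Y|X,Θ}` built from the `(x',θ)`-marginal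
of `Q`. -/
def refMeas [Fintype 𝒳] [Fintype 𝒴] [Fintype 𝒯] (W : 𝒯 → 𝒳 → 𝒴 → ℝ) (PX : 𝒳 → ℝ)
    (Q : 𝒳 × 𝒳 × 𝒯 × 𝒴 → ℝ) : 𝒳 × 𝒳 × 𝒯 × 𝒴 → ℝ :=
  fun p => PX p.1 * (∑ x : 𝒳, ∑ y : 𝒴, Q (x, p.2.1, p.2.2.1, y)) * W p.2.2.1 p.1 p.2.2.2

/-- The set `D_η` of joint distributions within divergence `η` of the reference measure. -/
def Dset [Fintype 𝒳] [Fintype 𝒴] [Fintype 𝒯] (W : 𝒯 → 𝒳 → 𝒴 → ℝ) (PX : 𝒳 → ℝ)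
    (η : ℝ) : Set (𝒳 × 𝒳 × 𝒯 × 𝒴 → ℝ) :=
  {Q | IsDist Q ∧ klDiv Q (refMeas W PX Q) ≤ η}

/-- `η*`: the infimum of `η ≥ 0` admitting a coupling whose two marginals lie in `D_η`. -/
def etaStar [Fintype 𝒳] [Fintype 𝒴] [Fintype 𝒯] (W : 𝒯 → 𝒳 → 𝒴 → ℝ) (PX : 𝒳 → ℝ) : ℝ :=
  sInf {η : ℝ | 0 ≤ η ∧ ∃ Q : 𝒳 × 𝒳 × 𝒯 × 𝒯 × 𝒴 → ℝ, IsDist Q ∧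
      (fun p : 𝒳 × 𝒳 × 𝒯 × 𝒴 =>
        ∑ θ' : 𝒯, Q (p.1, p.2.1, p.2.2.1, θ', p.2.2.2)) ∈ Dset W PX η ∧
      (fun p : 𝒳 × 𝒳 × 𝒯 × 𝒴 =>
        ∑ θ : 𝒯, Q (p.2.1, p.1, θ, p.2.2.1, p.2.2.2)) ∈ Dset W PX η}

/-- Joint type (empirical distribution) of four `d`-letter strings. -/
def jointType4 [Fintype 𝒳] [Fintype 𝒴] [Fintype 𝒯] (d : ℕ)
    (x xb : Fin d → 𝒳) (θ : Fin d → 𝒯) (y : Fin d → 𝒴) : 𝒳 × 𝒳 × 𝒯 × 𝒴 → ℝ :=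
  fun a => ((Finset.univ.filter (fun i : Fin d => (x i, xb i, θ i, y i) = a)).card : ℝ) / d

/-- `T` is a type (empirical distribution) of a `d`-letter state sequence. -/
def IsTypeOf [Fintype 𝒯] (d : ℕ) (T : 𝒯 → ℝ) : Prop :=
  ∃ θ : Fin d → 𝒯, ∀ t, T t = ((Finset.univ.filter (fun i : Fin d => θ i = t)).card : ℝ) / d

end AVCGame

open AVCGame Filter

namespace AVCGame

lemma IsDist.le_one {α : Type*} [Fintype α] {p : α → ℝ} (hp : IsDist p) (a : α) : p a ≤ 1 :=
  hp.2 ▸ Finset.single_le_sum (fun b _ => hp.1 b) (Finset.mem_univ a)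

lemma isDist_pi_single {α : Type*} [Fintype α] (a : α) : IsDist (Pi.single a (1 : ℝ)) :=
  ⟨fun b => by by_cases h : b = a <;> simp [h], by simp⟩

lemma nonempty_kernel (α β : Type*) [Fintype β] [Nonempty β] : Nonempty (Kernel α β) :=
  ⟨⟨fun _ => Pi.single (Classical.arbitrary β) 1, fun _ => isDist_pi_single _⟩⟩

lemma ind_nonneg (P : Prop) : 0 ≤ ind P := by
  unfold ind; split_ifs <;> norm_num

lemma ind_le_one (P : Prop) : ind P ≤ 1 := by
  unfold ind; split_ifs <;> norm_num

section ErrorBounds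

variable {𝒮 𝒳 𝒴 𝒯 : Type*} [Fintype 𝒮] [Fintype 𝒴]
  {W : 𝒯 → 𝒳 → 𝒴 → ℝ} {PS : 𝒮 → ℝ}

lemma nCh_nonneg (hW : ∀ θ x, IsDist (W θ x)) (n : ℕ) (θ : Fin n → 𝒯) (x : Fin n → 𝒳)
    (y : Fin n → 𝒴) : 0 ≤ nCh W n θ x y :=
  Finset.prod_nonneg fun _ _ => (hW _ _).1 _

lemma nCh_le_one (hW : ∀ θ x, IsDist (W θ x)) (n : ℕ) (θ : Fin n → 𝒯) (x : Fin n → 𝒳)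
    (y : Fin n → 𝒴) : nCh W n θ x y ≤ 1 :=
  Finset.prod_le_one (fun _ _ => (hW _ _).1 _) fun _ _ => (hW _ _).le_one _

lemma prodF_nonneg (hPS : IsDist PS) (k : ℕ) (s : Fin k → 𝒮) : 0 ≤ prodF PS k s :=
  Finset.prod_nonneg fun _ _ => hPS.1 _

lemma prodF_le_one (hPS : IsDist PS) (k : ℕ) (s : Fin k → 𝒮) : prodF PS k s ≤ 1 :=
  Finset.prod_le_one (fun _ _ => hPS.1 _) fun _ _ => hPS.le_one _

variable [Fintype 𝒳] [Fintype 𝒯]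

lemma errP_nonneg (hW : ∀ θ x, IsDist (W θ x)) (hPS : IsDist PS) (dS : 𝒮 → 𝒮 → ℝ) (D : ℝ)
    (k n : ℕ) (A : Kernel (Fin k → 𝒮) (Fin n → 𝒳)) (B : Kernel (Fin n → 𝒴) (Fin k → 𝒮))
    (q : ProbDist (Fin n → 𝒯)) : 0 ≤ errP W PS dS D k n A.1 B.1 q.1 := by
  unfold errP
  refine Finset.sum_nonneg fun θ _ => Finset.sum_nonneg fun s _ => Finset.sum_nonneg fun x _ =>
    Finset.sum_nonneg fun y _ => Finset.sum_nonneg fun s' _ => ?_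
  have h1 := ind_nonneg (dBlock dS k s s' > D)
  have h2 := q.2.1 θ
  have h3 := prodF_nonneg hPS k s
  have h4 := (A.2 s).1 x
  have h5 := nCh_nonneg hW n θ x y
  have h6 := (B.2 y).1 s'
  positivity

lemma exists_errP_le (hW : ∀ θ x, IsDist (W θ x)) (hPS : IsDist PS) (dS : 𝒮 → 𝒮 → ℝ) (D : ℝ)
    (k n : ℕ) :
    ∃ C : ℝ, ∀ (A : Kernel (Fin k → 𝒮) (Fin n → 𝒳)) (B : Kernel (Fin n → 𝒴) (Fin k → 𝒮))
      (q : ProbDist (Fin n → 𝒯)), errP W PS dS D k n A.1 B.1 q.1 ≤ C := by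
  refine ⟨∑ _θ : Fin n → 𝒯, ∑ _s : Fin k → 𝒮, ∑ _x : Fin n → 𝒳, ∑ _y : Fin n → 𝒴,
    ∑ _s' : Fin k → 𝒮, 1, fun A B q => ?_⟩
  unfold errP
  refine Finset.sum_le_sum fun θ _ => Finset.sum_le_sum fun s _ => Finset.sum_le_sum fun x _ =>
    Finset.sum_le_sum fun y _ => Finset.sum_le_sum fun s' _ => ?_
  have h2 := q.2.1 θ
  have h3 := prodF_nonneg hPS k s
  have h4 := (A.2 s).1 x
  have h5 := nCh_nonneg hW n θ x y
  have h6 := (B.2 y).1 s'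
  exact mul_le_one₀ (mul_le_one₀ (mul_le_one₀ (mul_le_one₀ (mul_le_one₀ (ind_le_one _) h2
    (q.2.le_one θ)) h3 (prodF_le_one hPS k s)) h4 ((A.2 s).le_one x)) h5
    (nCh_le_one hW n θ x y)) h6 ((B.2 y).le_one s')

lemma errP_eq_sum_avgChnQ (W : 𝒯 → 𝒳 → 𝒴 → ℝ) (PS : 𝒮 → ℝ) (dS : 𝒮 → 𝒮 → ℝ) (D : ℝ)
    (k n : ℕ) (A : (Fin k → 𝒮) → (Fin n → 𝒳) → ℝ) (B : (Fin n → 𝒴) → (Fin k → 𝒮) → ℝ)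
    (q : (Fin n → 𝒯) → ℝ) :
    errP W PS dS D k n A B q = ∑ s, ∑ x, ∑ y, ∑ s',
      A s x * B y s' * (ind (dBlock dS k s s' > D) * prodF PS k s * avgChnQ W n q x y) := by
  unfold errP avgChnQ
  rw [Finset.sum_comm]
  refine Finset.sum_congr rfl fun s _ => ?_
  rw [Finset.sum_comm]
  refine Finset.sum_congr rfl fun x _ => ?_
  rw [Finset.sum_comm]
  refine Finset.sum_congr rfl fun y _ => ?_
  rw [Finset.sum_comm]
  refine Finset.sum_congr rfl fun s' _ => ?_
  simp only [Finset.mul_sum]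
  exact Finset.sum_congr rfl fun θ _ => by ring

end ErrorBounds

lemma IsDist.le_sum_mul {α : Type*} [Fintype α] {p f : α → ℝ} {c : ℝ} (hp : IsDist p)
    (h : ∀ a, c ≤ f a) : c ≤ ∑ a, p a * f a :=
  calc c = ∑ a, p a * c := by rw [← Finset.sum_mul, hp.2, one_mul]
    _ ≤ _ := Finset.sum_le_sum fun a _ => mul_le_mul_of_nonneg_left (h a) (hp.1 a)

/-- Weak duality for the bilinear program over a pair of kernels. -/
lemma sum_add_sum_le_of_dual_feasible {S X Y T : Type*} [Fintype S] [Fintype X] [Fintype Y]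
    [Fintype T] {A : S → X → ℝ} {B : Y → T → ℝ} (hA : ∀ s, IsDist (A s))
    (hB : ∀ y, IsDist (B y)) {a : S → ℝ} {b : Y → ℝ} {u : S → T → Y → ℝ} {v : X → S → Y → ℝ}
    {c : S → X → Y → T → ℝ} (hv : ∀ x s, a s ≤ ∑ y, v x s y) (hu : ∀ t y, b y ≤ ∑ s, u s t y)
    (hc : ∀ s x y t, u s t y + v x s y ≤ c s x y t) :
    ∑ s, a s + ∑ y, b y ≤ ∑ s, ∑ x, ∑ y, ∑ t, A s x * B y t * c s x y t := by
  have ha : ∑ s, a s ≤ ∑ s, ∑ x, ∑ y, ∑ t, A s x * B y t * v x s y := by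
    refine Finset.sum_le_sum fun s _ => ?_
    refine ((hA s).le_sum_mul fun x => hv x s).trans_eq ?_
    refine Finset.sum_congr rfl fun x _ => ?_
    rw [Finset.mul_sum]
    refine Finset.sum_congr rfl fun y _ => ?_
    rw [← Finset.sum_mul, ← Finset.mul_sum, (hB y).2, mul_one]
  have hb : ∑ y, b y ≤ ∑ s, ∑ x, ∑ y, ∑ t, A s x * B y t * u s t y := by
    calc ∑ y, b y ≤ ∑ y, ∑ t, B y t * ∑ s, u s t y :=
          Finset.sum_le_sum fun y _ => (hB y).le_sum_mul fun t => hu t y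
      _ = ∑ y, ∑ s, ∑ t, B y t * u s t y := by
          refine Finset.sum_congr rfl fun y _ => ?_
          rw [Finset.sum_comm]
          simp only [Finset.mul_sum]
      _ = ∑ s, ∑ y, ∑ t, B y t * u s t y := Finset.sum_comm
      _ = _ := by
          refine Finset.sum_congr rfl fun s _ => ?_
          simp only [mul_assoc, ← Finset.mul_sum]
          rw [← Finset.sum_mul, (hA s).2, one_mul]
  refine (add_le_add ha hb).trans ?_
  simp only [← Finset.sum_add_distrib]
  refine Finset.sum_le_sum fun s _ => Finset.sum_le_sum fun x _ => Finset.sum_le_sum fun y _ =>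
    Finset.sum_le_sum fun t _ => ?_
  rw [← mul_add, add_comm]
  exact mul_le_mul_of_nonneg_left (hc s x y t) (mul_nonneg ((hA s).1 x) ((hB y).1 t))

end AVCGame

/-- Weak-duality lower bound on the maximin value: any dual-feasible
multipliers `(γ^S, γ^C, λ^S, λ^C)` for the LP relaxation of `SC(q)` give a lower bound
on the lower value of the game. -/
theorem weak_duality_lower_bound
    {𝒮 𝒳 𝒴 𝒯 : Type*} [Fintype 𝒮] [Fintype 𝒳] [Fintype 𝒴] [Fintype 𝒯]
    [Nonempty 𝒮] [Nonempty 𝒳] [Nonempty 𝒴] [Nonempty 𝒯]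
    (W : 𝒯 → 𝒳 → 𝒴 → ℝ) (hW : ∀ θ x, IsDist (W θ x))
    (PS : 𝒮 → ℝ) (hPS : IsDist PS)
    (dS : 𝒮 → 𝒮 → ℝ) (hdS : ∀ s s', 0 ≤ dS s s') (D : ℝ) (hD : 0 ≤ D)
    (k n : ℕ)
    (q : ProbDist (Fin n → 𝒯))
    (γS : (Fin k → 𝒮) → ℝ) (γC : (Fin n → 𝒴) → ℝ)
    (lamS : (Fin k → 𝒮) → (Fin k → 𝒮) → (Fin n → 𝒴) → ℝ)
    (lamC : (Fin n → 𝒳) → (Fin k → 𝒮) → (Fin n → 𝒴) → ℝ)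
    -- dual feasibility (I)
    (hI : ∀ (x : Fin n → 𝒳) (s : Fin k → 𝒮), γS s ≤ ∑ y : Fin n → 𝒴, lamC x s y)
    -- dual feasibility (II)
    (hII : ∀ (s' : Fin k → 𝒮) (y : Fin n → 𝒴), γC y ≤ ∑ s : Fin k → 𝒮, lamS s s' y)
    -- dual feasibility (III)
    (hIII : ∀ (s : Fin k → 𝒮) (x : Fin n → 𝒳) (y : Fin n → 𝒴) (s' : Fin k → 𝒮),
      lamS s s' y + lamC x s y ≤
        ind (dBlock dS k s s' > D) * prodF PS k s * avgChnQ W n q.1 x y) :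
    lowerVal W PS dS D k n ≥ (∑ s : Fin k → 𝒮, γS s) + ∑ y : Fin n → 𝒴, γC y := by
  have hnA := nonempty_kernel (Fin k → 𝒮) (Fin n → 𝒳)
  have hnB := nonempty_kernel (Fin n → 𝒴) (Fin k → 𝒮)
  have h0 := errP_nonneg (W := W) hW hPS dS D k n
  have hbdd : BddAbove (Set.range fun q : ProbDist (Fin n → 𝒯) =>
      ⨅ A : Kernel (Fin k → 𝒮) (Fin n → 𝒳), ⨅ B : Kernel (Fin n → 𝒴) (Fin k → 𝒮),
        errP W PS dS D k n A.1 B.1 q.1) := by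
    obtain ⟨A⟩ := hnA
    obtain ⟨B⟩ := hnB
    obtain ⟨C, hC⟩ := exists_errP_le (W := W) hW hPS dS D k n
    refine ⟨C, Set.forall_mem_range.2 fun q => ?_⟩
    exact (ciInf_le ⟨0, Set.forall_mem_range.2 fun A' => Real.iInf_nonneg fun B' =>
      h0 A' B' q⟩ A).trans <| (ciInf_le ⟨0, Set.forall_mem_range.2 fun B' =>
      h0 A B' q⟩ B).trans (hC A B q)
  refine le_trans ?_ (le_ciSup hbdd q)
  refine le_ciInf fun A => le_ciInf fun B => ?_
  rw [errP_eq_sum_avgChnQ]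
  exact sum_add_sum_le_of_dual_feasible A.2 B.2 hI hII hIII
end
end

section
/- Weakened random joint source-channel code achievability: fix k, n ∈ ℕ, a codeword distribution P_X ∈ 𝒫(𝒳^n), a source codebook distribution P_Ŝ ∈ 𝒫(𝒮^k) with P_Ŝ(B_𝐝(s)) > 0 for all s, and a capacity-achieving state distribution q*_Θ ∈ Π_Θ with q*(θ) = ∏_{i=1}^n q*_Θ(θ_i). Then there exists a random joint source-channel code ψ such that e_𝐝(ψ) ≤ inf_{γ>0} max_{θ ∈ 𝒯^n} ( 𝔼[ exp( −| i_{X;Y_{q*}}(X;Y) − log( γ / P_Ŝ(B_𝐝(S)) ) |⁺ ) | θ ] + e^{1−γ} ), where the conditional law given θ of (S,X,Y) is P_S(s) P_X(x) P_{Y|X,Θ}(y|x,θ), i_{X;Y_{q*}}(x;y) = log[ (q* P_{Y|X,Θ})(y|x) / Σ_{x'} P_X(x') (q* P_{Y|X,Θ})(y|x') ], B_𝐝(s) = { ŝ ∈ 𝒮^k : d(s,ŝ) ≤ 𝐝 }, |a|⁺ = max(a,0), and e^{1−γ} is in natural base. -/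
open scoped BigOperators
open Classical MeasureTheory Filter

noncomputable section

open AVCGame Filter

namespace AVCGame

lemma ind_true {P : Prop} (h : P) : ind P = 1 := if_pos h

lemma ind_false {P : Prop} (h : ¬P) : ind P = 0 := if_neg h

section ProductLaw

variable {A : Type*} [Fintype A] {p : A → ℝ} {N : ℕ}

lemma sum_prod_pi (g : Fin N → A → ℝ) :
    ∑ c : Fin N → A, ∏ i, g i (c i) = ∏ i, ∑ a, g i a := by
  rw [Finset.prod_univ_sum, Fintype.piFinset_univ]

lemma sum_prodF_mul_prod (p : A → ℝ) (g : Fin N → A → ℝ) :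
    ∑ c, prodF p N c * ∏ i, g i (c i) = ∏ i, ∑ a, p a * g i a := by
  rw [← sum_prod_pi]
  simp [prodF, Finset.prod_mul_distrib]

lemma IsDist.prodF (hp : IsDist p) (N : ℕ) : IsDist (prodF p N) := by
  refine ⟨fun c => Finset.prod_nonneg fun i _ => hp.1 _, ?_⟩
  have := sum_prodF_mul_prod (N := N) p (fun _ _ => 1)
  simpa [hp.2] using this

lemma sum_prodF_eval (hp : IsDist p) (w : Fin N) (g : A → ℝ) :
    ∑ c, prodF p N c * g (c w) = ∑ a, p a * g a := by
  have := sum_prodF_mul_prod p (fun i a => if i = w then g a else 1)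
  simp only [Finset.prod_ite_eq', Finset.mem_univ, if_true] at this
  rw [this, Finset.prod_eq_single w]
  · simp
  · intro i _ hi; simp [hi, hp.2]
  · simp

lemma sum_prodF_eval_mul_eval (hp : IsDist p) {w m : Fin N} (hwm : m ≠ w) (g h : A → ℝ) :
    ∑ c, prodF p N c * (g (c w) * h (c m)) = (∑ a, p a * g a) * ∑ b, p b * h b := by
  have := sum_prodF_mul_prod p
    (fun i a => (if i = w then g a else 1) * (if i = m then h a else 1))
  simp only [Finset.prod_mul_distrib, Finset.prod_ite_eq', Finset.mem_univ, if_true] at this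
  rw [this]
  have key : ∀ i, (∑ a, p a * ((if i = w then g a else 1) * (if i = m then h a else 1)))
      = (if i = w then ∑ a, p a * g a else 1) * (if i = m then ∑ b, p b * h b else 1) := by
    intro i
    by_cases hi : i = w
    · subst hi; simp [hwm.symm]
    · by_cases hm : i = m <;> simp [hi, hm, hp.2, hwm]
  rw [Finset.prod_congr rfl fun i _ => key i, Finset.prod_mul_distrib]
  simp

lemma sum_prodF_eval₂ (hp : IsDist p) {w m : Fin N} (hwm : m ≠ w) (F : A → A → ℝ) :
    ∑ c, prodF p N c * F (c w) (c m) = ∑ a, p a * ∑ b, p b * F a b := by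
  have h1 : ∀ c : Fin N → A, prodF p N c * F (c w) (c m)
      = ∑ a, prodF p N c * ((if c w = a then 1 else 0) * F a (c m)) := by
    intro c; simp
  simp_rw [h1]
  rw [Finset.sum_comm]
  refine Finset.sum_congr rfl fun a _ => ?_
  rw [sum_prodF_eval_mul_eval hp hwm (fun u => if u = a then 1 else 0) (F a)]
  simp

lemma sum_prodF_forall_not (hp : IsDist p) (good : A → Prop) (S : Finset (Fin N)) :
    ∑ c, prodF p N c * ind (∀ i ∈ S, ¬good (c i))
      = (1 - ∑ a, ind (good a) * p a) ^ S.card := by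
  have h1 : ∀ c : Fin N → A, ind (∀ i ∈ S, ¬good (c i))
      = ∏ i, if i ∈ S then 1 - ind (good (c i)) else 1 := by
    intro c
    by_cases h : ∀ i ∈ S, ¬good (c i)
    · rw [ind_true h]
      refine (Finset.prod_eq_one fun i _ => ?_).symm
      split_ifs with hi
      · rw [ind_false (h i hi)]; norm_num
      · rfl
    · rw [ind_false h]
      push Not at h
      obtain ⟨i, hi, hg⟩ := h
      exact (Finset.prod_eq_zero (Finset.mem_univ i) (by simp [hi, ind_true hg])).symm
  simp_rw [h1]
  rw [sum_prodF_mul_prod p (fun i a => if i ∈ S then 1 - ind (good a) else 1)]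
  have h2 : ∀ i, (∑ a, p a * (if i ∈ S then 1 - ind (good a) else 1))
      = if i ∈ S then 1 - ∑ a, ind (good a) * p a else 1 := by
    intro i
    split_ifs
    · simp [mul_sub, hp.2, mul_comm]
    · simp [hp.2]
  simp_rw [h2]
  simp [Finset.prod_ite_mem]

end ProductLaw

lemma isDist_nCh {𝒳 𝒴 𝒯 : Type*} [Fintype 𝒴] {W : 𝒯 → 𝒳 → 𝒴 → ℝ}
    (hW : ∀ θ x, IsDist (W θ x)) (n : ℕ) (θ : Fin n → 𝒯) (x : Fin n → 𝒳) :
    IsDist (nCh W n θ x) := by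
  refine ⟨fun y => Finset.prod_nonneg fun i _ => (hW _ _).1 _, ?_⟩
  unfold nCh
  rw [sum_prod_pi (fun i y => W (θ i) (x i) y)]
  simp [(hW _ _).2]

lemma sum_ind_succ_le {N : ℕ} {z : ℝ} (hz : 0 ≤ z) :
    ∑ m : Fin N, ind ((m : ℝ) + 1 ≤ z) ≤ z := by
  have h1 : ∑ m : Fin N, ind ((m : ℝ) + 1 ≤ z)
      = ((Finset.univ.filter fun m : Fin N => (m : ℝ) + 1 ≤ z).card : ℝ) := by
    simp [ind]
  rw [h1]
  refine le_trans ?_ (Nat.floor_le hz)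
  have : (Finset.univ.filter fun m : Fin N => (m : ℝ) + 1 ≤ z).card
      ≤ (Finset.range ⌊z⌋₊).card := by
    refine Finset.card_le_card_of_injOn (fun m => (m : ℕ)) ?_ ?_
    · intro m hm
      have hm : (m : ℝ) + 1 ≤ z := by simpa using hm
      have : (m : ℕ) + 1 ≤ ⌊z⌋₊ := Nat.le_floor (by push_cast; exact hm)
      simp; omega
    · intro a _ b _ h
      exact Fin.ext h
  exact_mod_cast (by simpa using this)

section RandomCodebook

variable {A X Y : Type*} [Fintype A] [Fintype X] [Fintype Y] {N : ℕ}

/-- Union bound over the competing codewords, for the metric `r x / (m + 1)`: summing the tails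
`P (m + 1 ≤ Z)` over `m` costs only the mean of `Z`. -/
lemma sum_competitor_le {P : X → ℝ} (hP : IsDist P) {r : X → ℝ} (hr : ∀ x, 0 ≤ r x)
    (hPr : ∑ x, P x * r x ≤ 1) (w : Fin N) {v h : X → ℝ} (hv : ∀ x, 0 ≤ v x)
    (hh : ∀ x, 1 ≤ h x ∨ (0 < r x ∧ ((w : ℝ) + 1) / r x ≤ h x)) :
    ∑ c, prodF P N c *
        (v (c w) * ind (∃ m, m ≠ w ∧ r (c w) / ((w : ℝ) + 1) ≤ r (c m) / ((m : ℝ) + 1)))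
      ≤ ∑ x, P x * (v x * h x) := by
  have hw : (0 : ℝ) < (w : ℝ) + 1 := by positivity
  let F : Fin N → X → X → ℝ := fun m a b =>
    v a * ind (¬1 ≤ h a) * ind (r a / ((w : ℝ) + 1) ≤ r b / ((m : ℝ) + 1))
  have hF : ∀ m a b, 0 ≤ F m a b := fun m a b =>
    mul_nonneg (mul_nonneg (hv a) (ind_nonneg _)) (ind_nonneg _)
  have hpt : ∀ c : Fin N → X,
      v (c w) * ind (∃ m, m ≠ w ∧ r (c w) / ((w : ℝ) + 1) ≤ r (c m) / ((m : ℝ) + 1))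
        ≤ v (c w) * ind (1 ≤ h (c w)) + ∑ m ∈ Finset.univ.erase w, F m (c w) (c m) := by
    intro c
    have hs : 0 ≤ ∑ m ∈ Finset.univ.erase w, F m (c w) (c m) :=
      Finset.sum_nonneg fun m _ => hF _ _ _
    by_cases h1 : 1 ≤ h (c w)
    · rw [ind_true h1]
      nlinarith [mul_le_mul_of_nonneg_left (ind_le_one (∃ m, m ≠ w ∧
        r (c w) / ((w : ℝ) + 1) ≤ r (c m) / ((m : ℝ) + 1))) (hv (c w))]
    · by_cases h2 : ∃ m, m ≠ w ∧ r (c w) / ((w : ℝ) + 1) ≤ r (c m) / ((m : ℝ) + 1)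
      · obtain ⟨m, hm, hrm⟩ := h2
        have h3 := Finset.single_le_sum (f := fun m => F m (c w) (c m))
          (fun m _ => hF m (c w) (c m)) (Finset.mem_erase.2 ⟨hm, Finset.mem_univ m⟩)
        have h4 : F m (c w) (c m) = v (c w) := by
          simp only [F, ind_true h1, ind_true hrm, mul_one]
        rw [ind_true ⟨m, hm, hrm⟩, ind_false h1]
        simp only [h4] at h3
        linarith
      · rw [ind_false h2, mul_zero]
        exact add_nonneg (mul_nonneg (hv _) (ind_nonneg _)) hs
  have hsum : ∑ c, prodF P N c *
        (v (c w) * ind (∃ m, m ≠ w ∧ r (c w) / ((w : ℝ) + 1) ≤ r (c m) / ((m : ℝ) + 1)))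
      ≤ ∑ x, P x * (v x * ind (1 ≤ h x)) +
        ∑ m ∈ Finset.univ.erase w, ∑ a, P a * ∑ b, P b * F m a b := by
    refine (Finset.sum_le_sum fun c _ =>
      mul_le_mul_of_nonneg_left (hpt c) ((hP.prodF N).1 c)).trans_eq ?_
    simp_rw [mul_add, Finset.sum_add_distrib, Finset.mul_sum]
    rw [sum_prodF_eval hP w (fun x => v x * ind (1 ≤ h x)), Finset.sum_comm]
    congr 1
    refine Finset.sum_congr rfl fun m hm => ?_
    rw [sum_prodF_eval₂ hP (Finset.ne_of_mem_erase hm) (F m)]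
    simp_rw [Finset.mul_sum]
  refine hsum.trans ?_
  rw [Finset.sum_comm, ← Finset.sum_add_distrib]
  refine Finset.sum_le_sum fun a _ => ?_
  rw [← Finset.mul_sum, ← mul_add]
  refine mul_le_mul_of_nonneg_left ?_ (hP.1 a)
  rw [Finset.sum_comm]
  by_cases h1 : 1 ≤ h a
  · simp only [F, ind_true h1, ind_false (not_not.2 h1), mul_zero, zero_mul,
      Finset.sum_const_zero, add_zero]
    exact mul_le_mul_of_nonneg_left h1 (hv a)
  · obtain ⟨hra, hle⟩ := (hh a).resolve_left h1
    have hb : ∀ b, ∑ m ∈ Finset.univ.erase w, P b * F m a b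
        ≤ v a * (((w : ℝ) + 1) / r a) * (P b * r b) := by
      intro b
      have hz : 0 ≤ ((w : ℝ) + 1) / r a * r b := mul_nonneg (by positivity) (hr b)
      have h5 : ∀ m : Fin N, F m a b = v a * ind ((m : ℝ) + 1 ≤ ((w : ℝ) + 1) / r a * r b) := by
        intro m
        have hm : (0 : ℝ) < (m : ℝ) + 1 := by positivity
        have : (r a / ((w : ℝ) + 1) ≤ r b / ((m : ℝ) + 1))
            ↔ ((m : ℝ) + 1 ≤ ((w : ℝ) + 1) / r a * r b) := by
          rw [div_le_div_iff₀ hw hm, div_mul_eq_mul_div, le_div_iff₀ hra]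
          constructor <;> intro h <;> linarith
        simp only [F, ind_true h1, mul_one, this]
      simp_rw [h5]
      have h6 : ∑ m ∈ Finset.univ.erase w, ind ((m : ℝ) + 1 ≤ ((w : ℝ) + 1) / r a * r b)
          ≤ ((w : ℝ) + 1) / r a * r b :=
        (Finset.sum_le_sum_of_subset_of_nonneg (Finset.erase_subset _ _)
          fun _ _ _ => ind_nonneg _).trans (sum_ind_succ_le hz)
      rw [← Finset.mul_sum, ← Finset.mul_sum]
      calc _ ≤ P b * (v a * (((w : ℝ) + 1) / r a * r b)) :=
            mul_le_mul_of_nonneg_left (mul_le_mul_of_nonneg_left h6 (hv a)) (hP.1 b)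
        _ = _ := by ring
    have h7 := Finset.sum_le_sum fun b (_ : b ∈ Finset.univ) => hb b
    rw [← Finset.mul_sum] at h7
    have h8 : 0 ≤ v a * (((w : ℝ) + 1) / r a) := mul_nonneg (hv a) (by positivity)
    rw [ind_false h1, mul_zero, zero_add]
    calc _ ≤ v a * (((w : ℝ) + 1) / r a) * ∑ b, P b * r b := h7
      _ ≤ v a * (((w : ℝ) + 1) / r a) := mul_le_of_le_one_right h8 hPr
      _ ≤ v a * h a := mul_le_mul_of_nonneg_left hle (hv a)

/-- The index of the first good codeword has mean at most the inverse probability of being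
good. -/
lemma sum_first_index_le {R : A → ℝ} (hR : IsDist R) {good : A → Prop}
    (hB : 0 < ∑ a, ind (good a) * R a) {enc : (Fin N → A) → Fin N}
    (henc : ∀ a, (∃ i, good (a i)) → good (a (enc a)) ∧ ∀ i < enc a, ¬good (a i)) :
    ∑ a, prodF R N a * (ind (∃ i, good (a i)) * (((enc a : ℕ) : ℝ) + 1))
      ≤ 1 / ∑ a, ind (good a) * R a := by
  set B := ∑ a, ind (good a) * R a with hBdef
  have hB1 : B ≤ 1 := by
    rw [← hR.2]
    exact Finset.sum_le_sum fun a _ => mul_le_of_le_one_left (hR.1 a) (ind_le_one _)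
  have hpt : ∀ a : Fin N → A, ind (∃ i, good (a i)) * (((enc a : ℕ) : ℝ) + 1)
      ≤ ∑ j : Fin N, ind (∀ i ∈ Finset.Iio j, ¬good (a i)) := by
    intro a
    by_cases h : ∃ i, good (a i)
    · rw [ind_true h, one_mul]
      have h1 : ∑ j ∈ Finset.Iic (enc a), ind (∀ i ∈ Finset.Iio j, ¬good (a i))
          = ((enc a : ℕ) : ℝ) + 1 := by
        rw [Finset.sum_congr rfl fun j hj => ind_true fun i hi =>
          (henc a h).2 i (lt_of_lt_of_le (Finset.mem_Iio.1 hi) (Finset.mem_Iic.1 hj))]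
        simp [Fin.card_Iic]
      rw [← h1]
      exact Finset.sum_le_sum_of_subset_of_nonneg (Finset.subset_univ _)
        fun _ _ _ => ind_nonneg _
    · rw [ind_false h, zero_mul]
      exact Finset.sum_nonneg fun _ _ => ind_nonneg _
  have h1 : ∑ a, prodF R N a * (ind (∃ i, good (a i)) * (((enc a : ℕ) : ℝ) + 1))
      ≤ ∑ j : Fin N, (1 - B) ^ (j : ℕ) := by
    refine (Finset.sum_le_sum fun a _ =>
      mul_le_mul_of_nonneg_left (hpt a) ((hR.prodF N).1 a)).trans_eq ?_
    simp_rw [Finset.mul_sum]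
    rw [Finset.sum_comm]
    refine Finset.sum_congr rfl fun j _ => ?_
    rw [sum_prodF_forall_not hR good, Fin.card_Iio]
  refine h1.trans ?_
  rw [Fin.sum_univ_eq_sum_range (fun j => (1 - B) ^ j), le_div_iff₀ hB]
  have h2 := geom_sum_mul_neg (1 - B) N
  rw [sub_sub_cancel] at h2
  rw [h2]
  linarith [pow_nonneg (sub_nonneg.2 hB1) N]

/-- Error bound for the random codebook with first-match encoding and decoding by the maximum of
`r x y / (m + 1)`. -/
lemma sum_codebook_error_le {P : X → ℝ} (hP : IsDist P) {R : A → ℝ} (hR : IsDist R)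
    {V : X → Y → ℝ} (hV : ∀ x, IsDist (V x)) {good : A → Prop}
    (hB : 0 < ∑ a, ind (good a) * R a)
    {r : X → Y → ℝ} (hr : ∀ x y, 0 ≤ r x y) (hPr : ∀ y, ∑ x, P x * r x y ≤ 1)
    {enc : (Fin N → A) → Fin N}
    (henc : ∀ a, (∃ i, good (a i)) → good (a (enc a)) ∧ ∀ i < enc a, ¬good (a i))
    {dec : (Fin N → X) → Y → Fin N}
    (hdec : ∀ c y (m : Fin N), r (c m) y / ((m : ℝ) + 1)
      ≤ r (c (dec c y)) y / (((dec c y : ℕ) : ℝ) + 1))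
    {K : X → Y → ℝ}
    (hK : ∀ x y, 1 ≤ K x y ∨ (0 < r x y ∧ 1 / (∑ a, ind (good a) * R a) / r x y ≤ K x y)) :
    ∑ a, prodF R N a * ∑ c, prodF P N c *
        ∑ y, V (c (enc a)) y * ind (¬good (a (dec c y)))
      ≤ ∑ x, ∑ y, P x * V x y * K x y + (1 - ∑ a, ind (good a) * R a) ^ N := by
  set B := ∑ a, ind (good a) * R a with hBdef
  let h : Fin N → X → Y → ℝ := fun w x y =>
    if 1 ≤ K x y then 1 else ((w : ℝ) + 1) / r x y
  have hcode : ∀ a : Fin N → A, ∑ c, prodF P N c *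
        ∑ y, V (c (enc a)) y * ind (¬good (a (dec c y)))
      ≤ ind (∃ i, good (a i)) * (∑ y, ∑ x, P x * (V x y * h (enc a) x y))
        + ind (∀ i ∈ (Finset.univ : Finset (Fin N)), ¬good (a i)) := by
    intro a
    by_cases hg : ∃ i, good (a i)
    · have hn : ¬∀ i ∈ (Finset.univ : Finset (Fin N)), ¬good (a i) := by
        simpa using hg
      rw [ind_true hg, ind_false hn, one_mul, add_zero]
      simp_rw [Finset.mul_sum]
      rw [Finset.sum_comm]
      refine Finset.sum_le_sum fun y _ => ?_
      refine le_trans (Finset.sum_le_sum fun c _ => mul_le_mul_of_nonneg_left ?_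
        ((hP.prodF N).1 c)) (sum_competitor_le hP (fun x => hr x y) (hPr y) (enc a)
          (v := fun x => V x y) (h := fun x => h (enc a) x y) (fun x => (hV x).1 y) ?_)
      · refine mul_le_mul_of_nonneg_left ?_ ((hV _).1 y)
        by_cases hbad : good (a (dec c y))
        · rw [ind_false (not_not.2 hbad)]; exact ind_nonneg _
        · rw [ind_true hbad, ind_true ⟨dec c y, fun he => hbad (he ▸ (henc a hg).1),
            hdec c y (enc a)⟩]
      · intro x
        by_cases hx : 1 ≤ K x y
        · left; simp [h, hx]
        · right
          exact ⟨((hK x y).resolve_left hx).1, by simp [h, hx]⟩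
    · have hn : ∀ i ∈ (Finset.univ : Finset (Fin N)), ¬good (a i) :=
        fun i _ hi => hg ⟨i, hi⟩
      rw [ind_false hg, ind_true hn, zero_mul, zero_add, ← (hP.prodF N).2]
      refine Finset.sum_le_sum fun c _ => mul_le_of_le_one_right ((hP.prodF N).1 c) ?_
      rw [← (hV (c (enc a))).2]
      exact Finset.sum_le_sum fun y _ => mul_le_of_le_one_right ((hV _).1 y) (ind_le_one _)
  have hmean : ∀ x y, ∑ a, prodF R N a * (ind (∃ i, good (a i)) * h (enc a) x y) ≤ K x y := by
    intro x y
    by_cases hx : 1 ≤ K x y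
    · simp only [h, if_pos hx, mul_one]
      refine le_trans ?_ hx
      rw [← (hR.prodF N).2]
      exact Finset.sum_le_sum fun a _ => mul_le_of_le_one_right ((hR.prodF N).1 a) (ind_le_one _)
    · obtain ⟨hrx, hle⟩ := (hK x y).resolve_left hx
      refine le_trans ?_ hle
      simp only [h, if_neg hx, ← mul_div_assoc]
      rw [← Finset.sum_div]
      exact div_le_div_of_nonneg_right (sum_first_index_le hR hB henc) hrx.le
  calc _ ≤ ∑ a, prodF R N a *
          (ind (∃ i, good (a i)) * (∑ y, ∑ x, P x * (V x y * h (enc a) x y))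
            + ind (∀ i ∈ (Finset.univ : Finset (Fin N)), ¬good (a i))) :=
        Finset.sum_le_sum fun a _ => mul_le_mul_of_nonneg_left (hcode a) ((hR.prodF N).1 a)
    _ = ∑ a, prodF R N a *
          (ind (∃ i, good (a i)) * (∑ y, ∑ x, P x * (V x y * h (enc a) x y)))
        + (1 - B) ^ N := by
        simp_rw [mul_add, Finset.sum_add_distrib]
        rw [sum_prodF_forall_not hR good]
        simp [hBdef]
    _ = ∑ x, ∑ y, P x * V x y *
          (∑ a, prodF R N a * (ind (∃ i, good (a i)) * h (enc a) x y)) + (1 - B) ^ N := by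
        congr 1
        simp_rw [Finset.mul_sum]
        rw [Finset.sum_comm, Finset.sum_comm (s := (Finset.univ : Finset X))]
        refine Finset.sum_congr rfl fun y _ => ?_
        rw [Finset.sum_comm]
        refine Finset.sum_congr rfl fun x _ => Finset.sum_congr rfl fun a _ => ?_
        ring
    _ ≤ _ := by
        gcongr with x _ y _
        · exact mul_nonneg (hP.1 x) ((hV x).1 y)
        · exact hmean x y

end RandomCodebook

lemma exists_first {A : Type*} {M : ℕ} (good : A → Prop) (a : Fin (M + 1) → A) :
    ∃ w, (∃ i, good (a i)) → good (a w) ∧ ∀ i < w, ¬good (a i) := by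
  by_cases h : ∃ i, good (a i)
  · obtain ⟨w, hw, hmin⟩ := wellFounded_lt.has_min {i | good (a i)} h
    exact ⟨w, fun _ => ⟨hw, fun i hi hg => hmin i hg hi⟩⟩
  · exact ⟨0, fun hex => absurd hex h⟩

/-- Push-forward of a distribution along a map of finite types. -/
lemma exists_pushforward {U C : Type*} [Fintype U] [Fintype C] {μ : U → ℝ} (hμ : IsDist μ)
    (g : U → C) :
    ∃ ψ : ProbDist C, ∀ e : C → ℝ, ∑ c, ψ.1 c * e c = ∑ u, μ u * e (g u) := by
  have key : ∀ e : C → ℝ, ∑ c, (∑ u, μ u * ind (g u = c)) * e c = ∑ u, μ u * e (g u) := by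
    intro e
    simp_rw [Finset.sum_mul]
    rw [Finset.sum_comm]
    refine Finset.sum_congr rfl fun u _ => ?_
    rw [Finset.sum_eq_single (g u)]
    · rw [ind_true rfl, mul_one]
    · intro c _ hc; rw [ind_false hc.symm]; simp
    · simp
  refine ⟨⟨fun c => ∑ u, μ u * ind (g u = c), fun c =>
    Finset.sum_nonneg fun u _ => mul_nonneg (hμ.1 u) (ind_nonneg _), ?_⟩, key⟩
  simpa [hμ.2] using key fun _ => 1

/-- A minimum over distributions of a finite maximum of linear functionals is attained. -/
lemma exists_minimizer {C Θ : Type*} [Fintype C] [Nonempty C] [Fintype Θ] [Nonempty Θ]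
    (e : C → Θ → ℝ) :
    ∃ ψ : ProbDist C, ∀ ψ' : ProbDist C,
      ⨆ θ, ∑ c, ψ.1 c * e c θ ≤ ⨆ θ, ∑ c, ψ'.1 c * e c θ := by
  have hc : Continuous fun p : C → ℝ => ⨆ θ, ∑ c, p c * e c θ := by
    simp_rw [← Finset.sup'_univ_eq_ciSup]
    refine Continuous.finset_sup'_apply _ fun θ _ => ?_
    fun_prop
  have hne : (stdSimplex ℝ C).Nonempty :=
    ⟨_, single_mem_stdSimplex ℝ (Classical.arbitrary C)⟩
  obtain ⟨p, hp, hmin⟩ := (isCompact_stdSimplex ℝ C).exists_isMinOn hne hc.continuousOn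
  exact ⟨⟨p, hp⟩, fun ψ' => hmin ψ'.2⟩

lemma one_le_or_inv_le_rpow {r B γ : ℝ} (hr : 0 ≤ r) (hB : 0 < B) (hB1 : B ≤ 1) (hγ : 1 ≤ γ) :
    1 ≤ (2 : ℝ) ^ (-(max (Real.logb 2 r - Real.logb 2 (γ / B)) 0)) ∨
      (0 < r ∧ 1 / B / r ≤ (2 : ℝ) ^ (-(max (Real.logb 2 r - Real.logb 2 (γ / B)) 0))) := by
  have hγB : 1 ≤ γ / B := by rw [le_div_iff₀ hB]; linarith
  have hpos : 0 < γ / B := by linarith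
  by_cases h : Real.logb 2 r - Real.logb 2 (γ / B) ≤ 0
  · left; rw [max_eq_right h]; simp
  · have h0 : r ≠ 0 := by
      rintro rfl
      apply h
      have := Real.logb_nonneg (b := 2) (by norm_num) hγB
      simpa using this
    have hr0 : 0 < r := lt_of_le_of_ne hr h0.symm
    right
    refine ⟨hr0, ?_⟩
    rw [max_eq_left (not_le.1 h).le, neg_sub, Real.rpow_sub (by norm_num),
      Real.rpow_logb (by norm_num) (by norm_num) hpos,
      Real.rpow_logb (by norm_num) (by norm_num) hr0]
    gcongr

section Codes

variable {𝒮 𝒳 𝒴 𝒯 : Type*} [Fintype 𝒮] [Fintype 𝒴]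

lemma eCode_le_one {W : 𝒯 → 𝒳 → 𝒴 → ℝ} (hW : ∀ θ x, IsDist (W θ x)) {PS : 𝒮 → ℝ}
    (hPS : IsDist PS) (dS : 𝒮 → 𝒮 → ℝ) (D : ℝ) (k n : ℕ) (f : (Fin k → 𝒮) → Fin n → 𝒳)
    (φ : (Fin n → 𝒴) → Fin k → 𝒮) (θ : Fin n → 𝒯) :
    eCode W PS dS D k n f φ θ ≤ 1 := by
  rw [← (hPS.prodF k).2]
  refine Finset.sum_le_sum fun s _ => ?_
  have hs := (hPS.prodF k).1 s
  calc _ ≤ ∑ y, prodF PS k s * nCh W n θ (f s) y := by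
        refine Finset.sum_le_sum fun y _ => ?_
        rw [mul_assoc]
        exact mul_le_of_le_one_left (mul_nonneg hs ((isDist_nCh hW n θ _).1 y)) (ind_le_one _)
    _ = _ := by rw [← Finset.mul_sum, (isDist_nCh hW n θ _).2, mul_one]

/-- For `1 ≤ γ` some random code meets the bound for every state sequence. -/
lemma exists_random_code {k n : ℕ} [Fintype 𝒳] [Fintype 𝒯] [Fintype (CodePair 𝒮 𝒳 𝒴 k n)]
    {W : 𝒯 → 𝒳 → 𝒴 → ℝ} (hW : ∀ θ x, IsDist (W θ x)) {PS : 𝒮 → ℝ} (hPS : IsDist PS)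
    (dS : 𝒮 → 𝒮 → ℝ) (D : ℝ) (PX : ProbDist (Fin n → 𝒳)) (PShat : ProbDist (Fin k → 𝒮))
    (hball : ∀ s : Fin k → 𝒮, 0 < ballProb dS D k PShat.1 s) (q : ProbDist 𝒯)
    {γ : ℝ} (hγ : 1 ≤ γ) :
    ∃ ψ : ProbDist (CodePair 𝒮 𝒳 𝒴 k n), ∀ θ : Fin n → 𝒯,
      ∑ c, ψ.1 c * eCode W PS dS D k n c.1 c.2 θ ≤
        (∑ s : Fin k → 𝒮, ∑ x : Fin n → 𝒳, ∑ y : Fin n → 𝒴,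
          prodF PS k s * PX.1 x * nCh W n θ x y *
            (2 : ℝ) ^ (-(max (infoDens PX.1 (avgChn W q.1 n) x y -
              Real.logb 2 (γ / ballProb dS D k PShat.1 s)) 0))) + Real.exp (1 - γ) := by
  have hB1 : ∀ s, ballProb dS D k PShat.1 s ≤ 1 := by
    intro s
    rw [← PShat.2.2]
    exact Finset.sum_le_sum fun a _ => mul_le_of_le_one_left (PShat.2.1 a) (ind_le_one _)
  obtain ⟨M, hM⟩ : ∃ M : ℕ, ∀ s, (1 - ballProb dS D k PShat.1 s) ^ (M + 1)
      ≤ Real.exp (1 - γ) := by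
    have hev : ∀ᶠ M : ℕ in atTop, ∀ s, (1 - ballProb dS D k PShat.1 s) ^ (M + 1)
        ≤ Real.exp (1 - γ) := by
      rw [eventually_all]
      intro s
      have ht := (tendsto_pow_atTop_nhds_zero_of_lt_one (sub_nonneg.2 (hB1 s))
        (by linarith [hball s])).comp (tendsto_add_atTop_nat 1)
      exact ht.eventually_le_const (Real.exp_pos _)
    exact hev.exists
  let r : (Fin n → 𝒳) → (Fin n → 𝒴) → ℝ := fun x y =>
    avgChn W q.1 n x y / ∑ x', PX.1 x' * avgChn W q.1 n x' y
  have havg : ∀ x y, 0 ≤ avgChn W q.1 n x y := fun x y =>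
    Finset.sum_nonneg fun θ _ => mul_nonneg ((q.2.prodF n).1 θ) ((isDist_nCh hW n θ x).1 y)
  have hr : ∀ x y, 0 ≤ r x y := fun x y =>
    div_nonneg (havg x y) (Finset.sum_nonneg fun x' _ => mul_nonneg (PX.2.1 x') (havg x' y))
  have hPr : ∀ y, ∑ x, PX.1 x * r x y ≤ 1 := by
    intro y
    simp only [r, ← mul_div_assoc]
    rw [← Finset.sum_div]
    exact div_self_le_one _
  choose enc henc using fun s : Fin k → 𝒮 =>
    exists_first (M := M) fun s' : Fin k → 𝒮 => dBlock dS k s s' ≤ D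
  choose dec hdec using fun (c : Fin (M + 1) → Fin n → 𝒳) (y : Fin n → 𝒴) =>
    Finite.exists_max fun m : Fin (M + 1) => r (c m) y / ((m : ℝ) + 1)
  let μ : (Fin (M + 1) → Fin k → 𝒮) × (Fin (M + 1) → Fin n → 𝒳) → ℝ := fun u =>
    prodF PShat.1 (M + 1) u.1 * prodF PX.1 (M + 1) u.2
  have hμ : IsDist μ := by
    refine ⟨fun u => mul_nonneg ((PShat.2.prodF _).1 _) ((PX.2.prodF _).1 _), ?_⟩
    simp only [μ, Fintype.sum_prod_type, ← Finset.mul_sum, (PX.2.prodF _).2, mul_one,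
      (PShat.2.prodF _).2]
  obtain ⟨ψ, hψ⟩ := exists_pushforward hμ
    (fun u => ((fun s => u.2 (enc s u.1), fun y => u.1 (dec u.2 y)) : CodePair 𝒮 𝒳 𝒴 k n))
  refine ⟨ψ, fun θ => ?_⟩
  have hψθ := hψ fun c => eCode W PS dS D k n c.1 c.2 θ
  rw [hψθ]
  have hs : ∀ s : Fin k → 𝒮,
      ∑ a, prodF PShat.1 (M + 1) a * ∑ c, prodF PX.1 (M + 1) c *
        ∑ y, nCh W n θ (c (enc s a)) y * ind (¬dBlock dS k s (a (dec c y)) ≤ D)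
      ≤ ∑ x, ∑ y, PX.1 x * nCh W n θ x y *
          (2 : ℝ) ^ (-(max (infoDens PX.1 (avgChn W q.1 n) x y -
              Real.logb 2 (γ / ballProb dS D k PShat.1 s)) 0)) + Real.exp (1 - γ) := by
    intro s
    refine (sum_codebook_error_le PX.2 PShat.2 (isDist_nCh hW n θ) (hball s) hr hPr (henc s)
      hdec (fun x y => one_le_or_inv_le_rpow (hr x y) (hball s) (hB1 s) hγ)).trans ?_
    exact add_le_add le_rfl (hM s)
  calc _ = ∑ s, prodF PS k s * ∑ a, prodF PShat.1 (M + 1) a * ∑ c, prodF PX.1 (M + 1) c *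
        ∑ y, nCh W n θ (c (enc s a)) y * ind (¬dBlock dS k s (a (dec c y)) ≤ D) := by
        simp only [μ, eCode, Fintype.sum_prod_type, Finset.mul_sum, not_le, gt_iff_lt]
        rw [Finset.sum_comm_cycle]
        refine Finset.sum_congr rfl fun s _ => Finset.sum_congr rfl fun a _ =>
          Finset.sum_congr rfl fun c _ => Finset.sum_congr rfl fun y _ => ?_
        ring
    _ ≤ ∑ s, prodF PS k s * (∑ x, ∑ y, PX.1 x * nCh W n θ x y *
          (2 : ℝ) ^ (-(max (infoDens PX.1 (avgChn W q.1 n) x y -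
              Real.logb 2 (γ / ballProb dS D k PShat.1 s)) 0)) + Real.exp (1 - γ)) :=
        Finset.sum_le_sum fun s _ => mul_le_mul_of_nonneg_left (hs s) ((hPS.prodF k).1 s)
    _ = _ := by
        simp_rw [mul_add, Finset.sum_add_distrib]
        rw [← Finset.sum_mul, (hPS.prodF k).2, one_mul]
        simp_rw [Finset.mul_sum, mul_assoc]

end Codes

end AVCGame

/-- Weakened random joint source-channel code achievability (Theorem 7
of the paper), obtained by the choice `L = ⌊γ / P_Ŝ(B_D(S))⌋`. -/
theorem random_jscc_achievability_weak
    {𝒮 𝒳 𝒴 𝒯 : Type*} [Fintype 𝒮] [Fintype 𝒳] [Fintype 𝒴] [Fintype 𝒯]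
    [DecidableEq 𝒮] [DecidableEq 𝒴]
    [Nonempty 𝒮] [Nonempty 𝒳] [Nonempty 𝒴] [Nonempty 𝒯]
    (W : 𝒯 → 𝒳 → 𝒴 → ℝ) (hW : ∀ θ x, IsDist (W θ x))
    (PS : 𝒮 → ℝ) (hPS : IsDist PS)
    (dS : 𝒮 → 𝒮 → ℝ) (hdS : ∀ s s', 0 ≤ dS s s') (D : ℝ) (hD : 0 ≤ D)
    (k n : ℕ)
    (PX : ProbDist (Fin n → 𝒳)) (PShat : ProbDist (Fin k → 𝒮))
    (hball : ∀ s : Fin k → 𝒮, 0 < ballProb dS D k PShat.1 s)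
    (qstar : ProbDist 𝒯) (hqstar : qstar ∈ PiTheta W) :
    ∃ ψ : ProbDist (CodePair 𝒮 𝒳 𝒴 k n),
      eRandMax W PS dS D k n ψ.1
      ≤ ⨅ γ : {γ : ℝ // 0 < γ}, ⨆ θ : Fin n → 𝒯,
          ((∑ s : Fin k → 𝒮, ∑ x : Fin n → 𝒳, ∑ y : Fin n → 𝒴,
              prodF PS k s * PX.1 x * nCh W n θ x y *
                (2 : ℝ) ^ (-(max (infoDens PX.1 (avgChn W qstar.1 n) x y -
                    Real.logb 2 (γ.1 / ballProb dS D k PShat.1 s)) 0)))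
           + Real.exp (1 - γ.1)) := by
  obtain ⟨ψ, hmin⟩ := exists_minimizer fun (c : CodePair 𝒮 𝒳 𝒴 k n) (θ : Fin n → 𝒯) =>
    eCode W PS dS D k n c.1 c.2 θ
  refine ⟨ψ, le_ciInf fun γ => ?_⟩
  rcases le_total γ.1 1 with hγ | hγ
  · refine ciSup_le fun θ => le_trans ?_ (le_ciSup (Finite.bddAbove_range _) θ)
    have h1 : ∑ c, ψ.1 c * eCode W PS dS D k n c.1 c.2 θ ≤ 1 := by
      rw [← ψ.2.2]
      exact Finset.sum_le_sum fun c _ =>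
        mul_le_of_le_one_right (ψ.2.1 c) (eCode_le_one hW hPS dS D k n _ _ θ)
    refine (h1.trans (Real.one_le_exp (sub_nonneg.2 hγ))).trans (le_add_of_nonneg_left ?_)
    refine Finset.sum_nonneg fun s _ => Finset.sum_nonneg fun x _ =>
      Finset.sum_nonneg fun y _ => ?_
    exact mul_nonneg (mul_nonneg (mul_nonneg ((hPS.prodF k).1 s) (PX.2.1 x))
      ((isDist_nCh hW n θ x).1 y)) (by positivity)
  · obtain ⟨ψ', hψ'⟩ := exists_random_code (𝒳 := 𝒳) hW hPS dS D PX PShat hball qstar hγ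
    refine (hmin ψ').trans (ciSup_le fun θ => ?_)
    exact (hψ' θ).trans (le_ciSup (f := fun θ : Fin n → 𝒯 =>
      (∑ s : Fin k → 𝒮, ∑ x : Fin n → 𝒳, ∑ y : Fin n → 𝒴,
        prodF PS k s * PX.1 x * nCh W n θ x y *
          (2 : ℝ) ^ (-(max (infoDens PX.1 (avgChn W qstar.1 n) x y -
            Real.logb 2 (γ.1 / ballProb dS D k PShat.1 s)) 0))) + Real.exp (1 - γ.1))
      (Finite.bddAbove_range _) θ)
end
end

section
/- Antisymmetry of the decoding indicator: fix a set 𝒜 ⊆ 𝒳^{d}×𝒴^{d}, a distribution P_𝕏 with full support, and 0 < η < η* (with D_η and η* defined from P_𝕏 as in the non-symmetrizability lemma). Define Z : 𝒳^{d}×𝒳^{d}×𝒴^{d} → {0,1} by Z(x,x̄,y) = 1 if and only if (x,y) ∈ 𝒜 and either (x̄,y) ∉ 𝒜 or there exists θ ∈ 𝒯^{d} such that the joint type T_{x,x̄,θ,y} belongs to D_η; and Z(x,x̄,y) = 0 otherwise. Then Z(x,x̄,y)·Z(x̄,x,y) = 0 for all x, x̄ ∈ 𝒳^{d} and y ∈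 𝒴^{d}. -/
open scoped BigOperators
open Classical MeasureTheory Filter

noncomputable section

namespace AVCGame

/-- Empirical distribution of a finite string. -/
def empDist {α : Type*} (d : ℕ) (s : Fin d → α) (a : α) : ℝ :=
  ((Finset.univ.filter (fun i : Fin d => s i = a)).card : ℝ) / d

theorem isDist_empDist {α : Type*} [Fintype α] {d : ℕ} (hd : 0 < d) (s : Fin d → α) :
    IsDist (empDist d s) := by
  refine ⟨fun a => by unfold empDist; positivity, ?_⟩
  have hcard : ∑ a, (Finset.univ.filter (fun i : Fin d => s i = a)).card = d := by
    rw [← Finset.card_eq_sum_card_fiberwise (s := Finset.univ) (t := Finset.univ) (f := s)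
      (fun _ _ => Finset.mem_coe.2 (Finset.mem_univ _)), Finset.card_univ, Fintype.card_fin]
  have hd' : (d : ℝ) ≠ 0 := by positivity
  simp only [empDist]
  rw [← Finset.sum_div, ← Nat.cast_sum, hcard, div_self hd']

/-- Marginalization of an empirical distribution: if `s i = f b` means that `P i` holds and
that the component `t i` equals `b`, then summing over `b` gives the relative frequency of `P`. -/
theorem sum_empDist {α β : Type*} [Fintype β] (d : ℕ) (s : Fin d → α) (f : β → α)
    (t : Fin d → β) (P : Fin d → Prop) [DecidablePred P]
    (h : ∀ i b, s i = f b ↔ P i ∧ t i = b) :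
    ∑ b, empDist d s (f b) = ((Finset.univ.filter P).card : ℝ) / d := by
  simp only [empDist]
  rw [← Finset.sum_div, ← Nat.cast_sum,
    Finset.card_eq_sum_card_fiberwise (s := Finset.univ.filter P) (t := Finset.univ) (f := t)
      (fun _ _ => Finset.mem_coe.2 (Finset.mem_univ _))]
  simp only [Finset.filter_filter, h]

/-- If the joint types of `(x, xb, θ, y)` and `(xb, x, θ', y)` both lie in `D_η`, then the joint
type of `(x, xb, θ, θ', y)` is a coupling witnessing `η* ≤ η`. -/
theorem etaStar_le_of_jointType4_mem {𝒳 𝒴 𝒯 : Type*} [Fintype 𝒳] [Fintype 𝒴] [Fintype 𝒯]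
    {W : 𝒯 → 𝒳 → 𝒴 → ℝ} {PX : 𝒳 → ℝ} {η : ℝ} (hη : 0 ≤ η) {d : ℕ} (hd : 0 < d)
    {x xb : Fin d → 𝒳} {y : Fin d → 𝒴} {θ θ' : Fin d → 𝒯}
    (h : jointType4 d x xb θ y ∈ Dset W PX η) (h' : jointType4 d xb x θ' y ∈ Dset W PX η) :
    etaStar W PX ≤ η := by
  refine csInf_le ⟨0, fun _ hr => hr.1⟩
    ⟨hη, empDist d (fun i => (x i, xb i, θ i, θ' i, y i)), isDist_empDist hd _, ?_, ?_⟩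
  · convert h using 1
    funext p
    obtain ⟨a, b, t, c⟩ := p
    refine sum_empDist d _ (fun u => (a, b, t, u, c)) θ'
      (fun i => (x i, xb i, θ i, y i) = (a, b, t, c)) fun i u => ?_
    simp only [Prod.mk.injEq]
    tauto
  · convert h' using 1
    funext p
    obtain ⟨a, b, t, c⟩ := p
    refine sum_empDist d _ (fun u => (b, a, u, t, c)) θ
      (fun i => (xb i, x i, θ' i, y i) = (a, b, t, c)) fun i u => ?_
    simp only [Prod.mk.injEq]
    tauto

end AVCGame

open AVCGame Filter

/-- Antisymmetry of the decoding indicator `Z` built from a typical set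
`𝒜` and the divergence ball `D_η` with `0 < η < η*`. -/
theorem decoding_indicator_antisymmetric
    {𝒳 𝒴 𝒯 : Type*} [Fintype 𝒳] [Fintype 𝒴] [Fintype 𝒯]
    [Nonempty 𝒳] [Nonempty 𝒴] [Nonempty 𝒯]
    (W : 𝒯 → 𝒳 → 𝒴 → ℝ) (hW : ∀ θ x, IsDist (W θ x))
    (hsym : ¬ Symmetrizable W)
    (PX : 𝒳 → ℝ) (hPX : IsDist PX) (hfull : ∀ x, 0 < PX x)
    (η : ℝ) (hη0 : 0 < η) (hηlt : η < etaStar W PX)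
    (d : ℕ) (hd : 0 < d)
    (A : Set ((Fin d → 𝒳) × (Fin d → 𝒴)))
    (Z : (Fin d → 𝒳) → (Fin d → 𝒳) → (Fin d → 𝒴) → ℕ)
    (hZ01 : ∀ x xb y, Z x xb y = 0 ∨ Z x xb y = 1)
    (hZdef : ∀ x xb y, Z x xb y = 1 ↔
      ((x, y) ∈ A ∧ ((xb, y) ∉ A ∨
        ∃ θ : Fin d → 𝒯, jointType4 d x xb θ y ∈ Dset W PX η))) :
    ∀ x xb y, Z x xb y * Z xb x y = 0 := by
  intro x xb y
  rcases hZ01 x xb y with h | h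
  · rw [h, zero_mul]
  rcases hZ01 xb x y with h' | h'
  · rw [h', mul_zero]
  obtain ⟨hA, hor⟩ := (hZdef x xb y).1 h
  obtain ⟨hA', hor'⟩ := (hZdef xb x y).1 h'
  obtain ⟨θ, hθ⟩ := hor.resolve_left (not_not_intro hA')
  obtain ⟨θ', hθ'⟩ := hor'.resolve_left (not_not_intro hA)
  exact absurd (etaStar_le_of_jointType4_mem hη0.le hd hθ hθ') (not_le.2 hηlt)
end
end
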